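/- Let 0 < T < +∞ and let u, v : [0,T]×ℝ³ → ℝ³ and p : [0,T]×ℝ³ → ℝ be C^∞ up to t = 0, with |v(t,x)| = 1 for all (t,x), solving the non-stationary simplified Ericksen–Leslie system ∂_t u − Δu + (u·∇)u + div(∇v ⊙ ∇v) + ∇p = 0, ∂_t v − Δv + (u·∇)v − |∇v|² v = 0, div u = 0 on [0,T]×ℝ³. Let 0 < γ < 3 ≤ p < +∞ with η(γ,p) = γ/p − 3/p + 2/3 ≤ 0, and assume u ∈ M^p_{γ,0}L^p(0,T), each component of ∇v belongs to M^p_γ L^p(0,T), and sup_{R≥1} R^{−γ} ∫₀ᵀ ∫_{B_R} |p|^{p/2} dx dt < +∞. If the initial data satisfy u(0,·) = 0 and ∇v(0,·) = 0 (i.e. v(0,·) is a constant unit vector), then u ≡ 0 and ∇v ≡ 0 on [0,T]×ℝ³. -/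

import Mathlib

open MeasureTheory Filter Metric Real

noncomputable section

/-- Three-dimensional Euclidean space. -/
abbrev E3 : Type := EuclideanSpace ℝ (Fin 3)

/-- Partial derivative `∂_j f` of a scalar field. -/
def pd (j : Fin 3) (f : E3 → ℝ) (x : E3) : ℝ :=
  fderiv ℝ f x (EuclideanSpace.single j 1)

/-- Laplacian of a scalar field. -/
def lap (f : E3 → ℝ) (x : E3) : ℝ := ∑ j, pd j (pd j f) x

/-- The annulus `C(R/2, R)`. -/
def ann (R : ℝ) : Set E3 := {x : E3 | R / 2 < ‖x‖ ∧ ‖x‖ < R}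

/-- Euclidean length `|u(x)|` of a vector field. -/
def vecNorm (u : E3 → Fin 3 → ℝ) (x : E3) : ℝ := Real.sqrt (∑ i, (u x i) ^ 2)

/-- `|∇v|² = Σ_{i,k} (∂_i v_k)²`. -/
def gradSq (v : E3 → Fin 3 → ℝ) (x : E3) : ℝ :=
  ∑ i, ∑ k, (pd i (fun y => v y k) x) ^ 2

/-- The non-stationary simplified Ericksen–Leslie system on `[0,T] × ℝ³`:
`∂_t u − Δu + (u·∇)u + div(∇v ⊙ ∇v) + ∇p = 0`,
`∂_t v − Δv + (u·∇)v − |∇v|² v = 0`, `div u = 0`. -/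
def EvolEL (T : ℝ) (u : ℝ → E3 → Fin 3 → ℝ) (P : ℝ → E3 → ℝ)
    (v : ℝ → E3 → Fin 3 → ℝ) : Prop :=
  (∀ t ∈ Set.Icc (0 : ℝ) T, ∀ x : E3, ∀ i : Fin 3,
    deriv (fun s => u s x i) t - lap (fun y => u t y i) x
      + (∑ j, u t x j * pd j (fun y => u t y i) x)
      + (∑ j, ∑ k,
          pd j (fun y => pd i (fun z => v t z k) y * pd j (fun z => v t z k) y) x)
      + pd i (P t) x = 0) ∧
  (∀ t ∈ Set.Icc (0 : ℝ) T, ∀ x : E3, ∀ i : Fin 3,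
    deriv (fun s => v s x i) t - lap (fun y => v t y i) x
      + (∑ j, u t x j * pd j (fun y => v t y i) x)
      - gradSq (v t) x * v t x i = 0) ∧
  (∀ t ∈ Set.Icc (0 : ℝ) T, ∀ x : E3, ∑ j, pd j (fun y => u t y j) x = 0)

/-- Membership in the time–space local Morrey space `M^p_γ L^p(0,T)`. -/
def MemMorreyT (p γ T : ℝ) (f : ℝ → E3 → ℝ) : Prop :=
  (∀ R : ℝ, 0 < R → IntegrableOn (fun q : ℝ × E3 => |f q.1 q.2| ^ p)
      (Set.Icc 0 T ×ˢ ball (0 : E3) R) volume) ∧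
  ∃ C : ℝ, ∀ R : ℝ, 1 ≤ R →
    R ^ (-γ) * ∫ t in Set.Icc (0 : ℝ) T, ∫ x in ball (0 : E3) R, |f t x| ^ p ≤ C

/-- Membership in `M^p_{γ,0} L^p(0,T)`. -/
def MemMorreyT0 (p γ T : ℝ) (f : ℝ → E3 → ℝ) : Prop :=
  MemMorreyT p γ T f ∧
  Tendsto (fun R : ℝ =>
      R ^ (-γ) * ∫ t in Set.Icc (0 : ℝ) T, ∫ x in ann R, |f t x| ^ p)
    atTop (nhds 0)

theorem flux_eq {A : Type*} [CommRing A] [Algebra ℝ A] (D : Fin 3 → Derivation ℝ A A)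
    (hD : ∀ i j a, D i (D j a) = D j (D i a)) (u v w : Fin 3 → A) (P : A)
    (hw : ∀ i, w i - ∑ j, D j (D j (v i)) + ∑ j, u j * D j (v i)
      - (∑ i, ∑ k, D i (v k) ^ 2) * v i = 0)
    (hv : ∑ i, v i ^ 2 = 1) (j : Fin 3) :
    (∑ i, D i ((if i = j then ∑ l, u l ^ 2 - ∑ l, ∑ k, D l (v k) ^ 2 else 0)
        + 2 * ∑ k, D i (v k) * D j (v k)))
      + (-(u j * (∑ l, u l ^ 2 + 2 * P + ∑ l, ∑ k, D l (v k) ^ 2))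
        - 2 * ∑ i, ∑ k, D j (v k) * u i * D i (v k))
    = 2 * ∑ i, u i * D j (u i) - u j * (∑ l, u l ^ 2 + 2 * P + ∑ l, ∑ k, D l (v k) ^ 2)
      + 2 * ∑ k, D j (v k) * w k := by
  have hvj : ∑ k, 2 * (v k * D j (v k)) = 0 := by
    have := congrArg (D j) hv
    simpa [map_sum, Derivation.leibniz_pow, mul_assoc] using this
  have h2 : ∀ i (a : A), D i (2 * a) = 2 * D i a := by intro i a; simp [two_mul]
  have key : ∑ i, D i (if i = j then ∑ l, u l ^ 2 - ∑ l, ∑ k, D l (v k) ^ 2 else 0)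
      = 2 * ∑ i, u i * D j (u i) - 2 * ∑ l, ∑ k, D l (v k) * D l (D j (v k)) := by
    rw [Finset.sum_eq_single j (by intro b _ hb; simp [hb]) (by simp)]
    simp [map_sum, Derivation.leibniz_pow, hD j, Finset.mul_sum]
  simp only [map_add, Finset.sum_add_distrib, key, h2]
  simp only [Fin.sum_univ_three, map_add, Derivation.leibniz, smul_eq_mul] at *
  linear_combination -2 * D j (v 0) * hw 0 - 2 * D j (v 1) * hw 1 - 2 * D j (v 2) * hw 2
    - (D 0 (v 0) ^ 2 + D 0 (v 1) ^ 2 + D 0 (v 2) ^ 2 + (D 1 (v 0) ^ 2 + D 1 (v 1) ^ 2 + D 1 (v 2) ^ 2) +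
        (D 2 (v 0) ^ 2 + D 2 (v 1) ^ 2 + D 2 (v 2) ^ 2)) * hvj

theorem div_flux_eq {A : Type*} [CommRing A] [Algebra ℝ A] (D : Fin 3 → Derivation ℝ A A)
    (hD : ∀ i j a, D i (D j a) = D j (D i a)) (u ut v w : Fin 3 → A) (P : A)
    (hu : ∀ i, ut i - ∑ j, D j (D j (u i)) + ∑ j, u j * D j (u i)
      + (∑ j, ∑ k, D j (D i (v k) * D j (v k))) + D i P = 0)
    (hw : ∀ i, w i - ∑ j, D j (D j (v i)) + ∑ j, u j * D j (v i)
      - (∑ i, ∑ k, D i (v k) ^ 2) * v i = 0)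
    (hdiv : ∑ j, D j (u j) = 0)
    (hlap : ∑ k, v k * ∑ j, D j (D j (v k)) = - ∑ i, ∑ k, D i (v k) ^ 2) :
    ∑ j, D j (2 * ∑ i, u i * D j (u i)
        - u j * (∑ l, u l ^ 2 + 2 * P + ∑ l, ∑ k, D l (v k) ^ 2) + 2 * ∑ k, D j (v k) * w k)
    = 2 * (∑ i, u i * ut i + ∑ j, ∑ k, D j (v k) * D j (w k))
      + 2 * (∑ j, ∑ i, D j (u i) ^ 2
        + (∑ k, (∑ j, D j (D j (v k))) ^ 2 - (∑ i, ∑ k, D i (v k) ^ 2) ^ 2)) := by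
  have h2 : ∀ i (a : A), D i (2 * a) = 2 * D i a := by intro i a; simp [two_mul]
  have hsq : ∀ i (a : A), D i (a ^ 2) = 2 * (a * D i a) := by
    intro i a; simp [Derivation.leibniz_pow]
  have h10 := hD 1 0
  have h20 := hD 2 0
  have h21 := hD 2 1
  have hu0 := hu 0
  have hu1 := hu 1
  have hu2 := hu 2
  simp only [Fin.sum_univ_three, map_add, map_sub, h2, hsq, Derivation.leibniz, smul_eq_mul,
    h10, h20, h21] at hu0 hu1 hu2 hw hdiv hlap ⊢
  linear_combination (-2) * (u 0 * hu0 + u 1 * hu1 + u 2 * hu2)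
    + 2 * (D 0 (D 0 (v 0)) + D 1 (D 1 (v 0)) + D 2 (D 2 (v 0))) * hw 0
    + 2 * (D 0 (D 0 (v 1)) + D 1 (D 1 (v 1)) + D 2 (D 2 (v 1))) * hw 1
    + 2 * (D 0 (D 0 (v 2)) + D 1 (D 1 (v 2)) + D 2 (D 2 (v 2))) * hw 2
    + 2 * (D 0 (v 0) ^ 2 + D 0 (v 1) ^ 2 + D 0 (v 2) ^ 2 + (D 1 (v 0) ^ 2 + D 1 (v 1) ^ 2 + D 1 (v 2) ^ 2) +
        (D 2 (v 0) ^ 2 + D 2 (v 1) ^ 2 + D 2 (v 2) ^ 2)) * hlap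
    - (u 0 ^ 2 + u 1 ^ 2 + u 2 ^ 2 + 2 * P
      + (D 0 (v 0) ^ 2 + D 0 (v 1) ^ 2 + D 0 (v 2) ^ 2 + (D 1 (v 0) ^ 2 + D 1 (v 1) ^ 2 + D 1 (v 2) ^ 2) +
        (D 2 (v 0) ^ 2 + D 2 (v 1) ^ 2 + D 2 (v 2) ^ 2))) * hdiv

/-- The algebra of smooth scalar fields on `E3`. -/
def smoothAlg : Subalgebra ℝ (E3 → ℝ) where
  carrier := {f | ContDiff ℝ (⊤ : ℕ∞) f}
  mul_mem' {f g} hf hg := by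
    rw [Set.mem_ofPred_eq] at hf hg ⊢
    exact hf.mul hg
  add_mem' {f g} hf hg := by
    rw [Set.mem_ofPred_eq] at hf hg ⊢
    exact hf.add hg
  algebraMap_mem' c := by
    change ContDiff ℝ (⊤ : ℕ∞) fun _ : E3 => c
    exact contDiff_const

theorem smoothAlg_contDiff (f : smoothAlg) : ContDiff ℝ (⊤ : ℕ∞) (f : E3 → ℝ) := f.2

theorem smoothAlg_differentiableAt (f : smoothAlg) (x : E3) :
    DifferentiableAt ℝ (f : E3 → ℝ) x :=
  (smoothAlg_contDiff f).differentiable (by simp) x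

theorem smoothAlg_coe_two : ((2 : smoothAlg) : E3 → ℝ) = 2 := rfl

theorem contDiff_pd {f : E3 → ℝ} (hf : ContDiff ℝ (⊤ : ℕ∞) f) (j : Fin 3) :
    ContDiff ℝ (⊤ : ℕ∞) (pd j f) :=
  (hf.fderiv_right (m := (⊤ : ℕ∞)) (by simp)).clm_apply contDiff_const

theorem fderiv_fderiv_apply_comm {E : Type*} [NormedAddCommGroup E] [NormedSpace ℝ E]
    {f : E → ℝ} (hf : ContDiff ℝ (⊤ : ℕ∞) f) (x a b : E) :
    fderiv ℝ (fun y => fderiv ℝ f y a) x b = fderiv ℝ (fun y => fderiv ℝ f y b) x a := by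
  have hd : DifferentiableAt ℝ (fderiv ℝ f) x :=
    (hf.fderiv_right (m := (⊤ : ℕ∞)) (by simp)).differentiable (by simp) x
  have hs : IsSymmSndFDerivAt ℝ f x :=
    hf.contDiffAt.isSymmSndFDerivAt (by
      rw [minSmoothness_of_isRCLikeNormedField]
      exact WithTop.coe_le_coe.2 (le_top : (2 : ℕ∞) ≤ ⊤))
  rw [fderiv_clm_apply hd (differentiableAt_const a), fderiv_clm_apply hd (differentiableAt_const b)]
  simpa using hs b a

/-- The partial derivative as a derivation of the algebra of smooth functions. -/
def pdDer (j : Fin 3) : Derivation ℝ smoothAlg smoothAlg where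
  toFun f := ⟨pd j f, contDiff_pd (smoothAlg_contDiff f) j⟩
  map_add' f g := by
    ext x
    have hf := smoothAlg_differentiableAt f x
    have hg := smoothAlg_differentiableAt g x
    change fderiv ℝ ((f : E3 → ℝ) + (g : E3 → ℝ)) x _ = fderiv ℝ f x _ + fderiv ℝ g x _
    simp [fderiv_add hf hg]
  map_smul' c f := by
    ext x
    have hf := smoothAlg_differentiableAt f x
    change fderiv ℝ (c • (f : E3 → ℝ)) x _ = c • fderiv ℝ f x _
    simp [fderiv_const_smul hf]
  map_one_eq_zero' := by
    ext x
    change fderiv ℝ (fun _ : E3 => (1 : ℝ)) x _ = 0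
    simp
  leibniz' f g := by
    ext x
    have hf := smoothAlg_differentiableAt f x
    have hg := smoothAlg_differentiableAt g x
    change fderiv ℝ ((f : E3 → ℝ) * (g : E3 → ℝ)) x _
      = (f : E3 → ℝ) x * fderiv ℝ g x _ + (g : E3 → ℝ) x * fderiv ℝ f x _
    simp [fderiv_mul hf hg]

theorem coe_pdDer (j : Fin 3) (f : smoothAlg) : ((pdDer j f : smoothAlg) : E3 → ℝ) = pd j f := rfl

theorem pdDer_comm (i j : Fin 3) (f : smoothAlg) : pdDer i (pdDer j f) = pdDer j (pdDer i f) := by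
  ext x
  exact fderiv_fderiv_apply_comm f.2 x _ _

/-- Twice-differentiated part of the flux of `|u|² + |∇v|²`. -/
def fluxM (u v : E3 → Fin 3 → ℝ) (i j : Fin 3) (x : E3) : ℝ :=
  (if i = j then ∑ l, u x l ^ 2 - gradSq v x else 0)
    + 2 * ∑ k, pd i (fun y => v y k) x * pd j (fun y => v y k) x

/-- Once-differentiated part of the flux of `|u|² + |∇v|²`. -/
def fluxN (u v : E3 → Fin 3 → ℝ) (P : E3 → ℝ) (j : Fin 3) (x : E3) : ℝ :=
  -(u x j * (∑ l, u x l ^ 2 + 2 * P x + gradSq v x))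
    - 2 * ∑ i, ∑ k, pd j (fun y => v y k) x * u x i * pd i (fun y => v y k) x

theorem lap_inner_eq (D : Fin 3 → Derivation ℝ smoothAlg smoothAlg) (v : Fin 3 → smoothAlg)
    (hv : ∑ i, v i ^ 2 = 1) :
    ∑ k, v k * ∑ j, D j (D j (v k)) = - ∑ i, ∑ k, D i (v k) ^ 2 := by
  have h2 : ∀ i (a : smoothAlg), D i (2 * a) = 2 * D i a := by intro i a; simp [two_mul]
  have hj : ∀ j, (2 : smoothAlg) * ∑ k, (v k * D j (D j (v k)) + D j (v k) ^ 2) = 0 := by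
    intro j
    have := congrArg (fun a => D j (D j a)) hv
    simp only [map_sum, Derivation.leibniz_pow, Derivation.map_one_eq_zero, map_zero] at this
    rw [← this, Finset.mul_sum]
    refine Finset.sum_congr rfl fun k _ => ?_
    simp [smul_eq_mul, mul_add, two_mul]
    ring
  have hj' : ∀ j, ∑ k, (v k * D j (D j (v k)) + D j (v k) ^ 2) = 0 := by
    intro j
    have h := congrArg (fun a => (1 / 2 : ℝ) • a) (hj j)
    simpa [two_mul, smul_add, ← add_smul] using h
  have := Finset.sum_congr (rfl : (Finset.univ : Finset (Fin 3)) = _) fun j _ => hj' j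
  simp only [Finset.sum_add_distrib, Finset.sum_const_zero] at this
  rw [← eq_neg_iff_add_eq_zero] at this
  rw [← this, Finset.sum_comm]
  exact Finset.sum_congr rfl fun k _ => Finset.mul_sum _ _ _

theorem energy_density_le {u ut v w : E3 → Fin 3 → ℝ} {P : E3 → ℝ}
    (hus : ∀ i, ContDiff ℝ (⊤ : ℕ∞) fun x => u x i)
    (huts : ∀ i, ContDiff ℝ (⊤ : ℕ∞) fun x => ut x i)
    (hvs : ∀ i, ContDiff ℝ (⊤ : ℕ∞) fun x => v x i)
    (hws : ∀ i, ContDiff ℝ (⊤ : ℕ∞) fun x => w x i)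
    (hPs : ContDiff ℝ (⊤ : ℕ∞) P)
    (hu : ∀ x i, ut x i - lap (fun y => u y i) x
      + (∑ j, u x j * pd j (fun y => u y i) x)
      + (∑ j, ∑ k, pd j (fun y => pd i (fun z => v z k) y * pd j (fun z => v z k) y) x)
      + pd i P x = 0)
    (hw : ∀ x i, w x i - lap (fun y => v y i) x + (∑ j, u x j * pd j (fun y => v y i) x)
      - gradSq v x * v x i = 0)
    (hdiv : ∀ x, ∑ j, pd j (fun y => u y j) x = 0)
    (hv : ∀ x, ∑ i, v x i ^ 2 = 1) (x : E3) :
    2 * (∑ i, u x i * ut x i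
        + ∑ j, ∑ k, pd j (fun y => v y k) x * pd j (fun y => w y k) x)
      ≤ ∑ j, pd j (fun y => ∑ i, pd i (fluxM u v i j) y + fluxN u v P j y) x := by
  let U : Fin 3 → smoothAlg := fun i => ⟨fun x => u x i, hus i⟩
  let Ut : Fin 3 → smoothAlg := fun i => ⟨fun x => ut x i, huts i⟩
  let V : Fin 3 → smoothAlg := fun i => ⟨fun x => v x i, hvs i⟩
  let W : Fin 3 → smoothAlg := fun i => ⟨fun x => w x i, hws i⟩
  let Q : smoothAlg := ⟨P, hPs⟩
  have hU : ∀ i, Ut i - ∑ j, pdDer j (pdDer j (U i)) + ∑ j, U j * pdDer j (U i)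
      + (∑ j, ∑ k, pdDer j (pdDer i (V k) * pdDer j (V k))) + pdDer i Q = 0 := by
    intro i
    ext x
    have := hu x i
    simp only [lap] at this
    simp [coe_pdDer, Finset.sum_apply, -Derivation.leibniz]
    exact this
  have hW : ∀ i, W i - ∑ j, pdDer j (pdDer j (V i)) + ∑ j, U j * pdDer j (V i)
      - (∑ i, ∑ k, pdDer i (V k) ^ 2) * V i = 0 := by
    intro i
    ext x
    have := hw x i
    simp only [lap, gradSq] at this
    simp [coe_pdDer, Finset.sum_apply, -Derivation.leibniz]
    exact this
  have hdiv' : ∑ j, pdDer j (U j) = 0 := by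
    ext x
    simpa [coe_pdDer, Finset.sum_apply] using hdiv x
  have hV : ∑ i, V i ^ 2 = 1 := by
    ext x
    simpa [Finset.sum_apply] using hv x
  have hlap := lap_inner_eq pdDer V hV
  have hflux := flux_eq pdDer pdDer_comm U V W Q hW hV
  have key := div_flux_eq pdDer pdDer_comm U Ut V W Q hU hW hdiv' hlap
  simp only [← hflux] at key
  have hcs : gradSq v x ^ 2 ≤ ∑ k, (∑ j, pd j (pd j (fun y => v y k)) x) ^ 2 := by
    have h1 : ∑ k, v x k * ∑ j, pd j (pd j (fun y => v y k)) x = - gradSq v x := by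
      have := congrArg (fun f : smoothAlg => (f : E3 → ℝ) x) hlap
      simpa [coe_pdDer, Finset.sum_apply, gradSq, V] using this
    have h2 := Finset.sum_mul_sq_le_sq_mul_sq Finset.univ (fun k => v x k)
      (fun k => ∑ j, pd j (pd j (fun y => v y k)) x)
    rw [h1, hv x] at h2
    simpa using h2
  have hM : ∀ i j, (((if i = j then ∑ l, U l ^ 2 - ∑ l, ∑ k, pdDer l (V k) ^ 2 else 0)
        + 2 * ∑ k, pdDer i (V k) * pdDer j (V k) : smoothAlg) : E3 → ℝ) = fluxM u v i j := by
    intro i j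
    ext y
    by_cases h : i = j <;> simp [h, fluxM, gradSq, coe_pdDer, Finset.sum_apply, smoothAlg_coe_two, U, V]
  have hN : ∀ j, ((-(U j * (∑ l, U l ^ 2 + 2 * Q + ∑ l, ∑ k, pdDer l (V k) ^ 2))
        - 2 * ∑ i, ∑ k, pdDer j (V k) * U i * pdDer i (V k) : smoothAlg) : E3 → ℝ)
      = fluxN u v P j := by
    intro j
    ext y
    simp [fluxN, gradSq, coe_pdDer, Finset.sum_apply, smoothAlg_coe_two, U, V, Q]
  have hR : ∀ j, (((∑ i, pdDer i ((if i = j then ∑ l, U l ^ 2 - ∑ l, ∑ k, pdDer l (V k) ^ 2 else 0)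
        + 2 * ∑ k, pdDer i (V k) * pdDer j (V k)))
      + (-(U j * (∑ l, U l ^ 2 + 2 * Q + ∑ l, ∑ k, pdDer l (V k) ^ 2))
        - 2 * ∑ i, ∑ k, pdDer j (V k) * U i * pdDer i (V k)) : smoothAlg) : E3 → ℝ)
      = fun y => ∑ i, pd i (fluxM u v i j) y + fluxN u v P j y := by
    intro j
    ext y
    rw [Subalgebra.coe_add, hN, Pi.add_apply]
    congr 1
    rw [AddSubmonoidClass.coe_finsetSum, Finset.sum_apply]
    exact Finset.sum_congr rfl fun i _ => by rw [coe_pdDer, hM]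
  have key' := congrArg (fun f : smoothAlg => (f : E3 → ℝ) x) key
  simp only [AddSubmonoidClass.coe_finsetSum, Finset.sum_apply, coe_pdDer, hR] at key'
  rw [key']
  have hpos : 0 ≤ ∑ j, ∑ i, pd j (fun y => u y i) x ^ 2 := by positivity
  simp only [gradSq] at hcs
  simp [coe_pdDer, Finset.sum_apply, smoothAlg_coe_two, U, Ut, V, W]
  linarith

theorem hasCompactSupport_pd {φ : E3 → ℝ} (hs : HasCompactSupport φ) (j : Fin 3) :
    HasCompactSupport (pd j φ) :=
  (hs.fderiv (𝕜 := ℝ)).comp_left (g := fun L : E3 →L[ℝ] ℝ => L (EuclideanSpace.single j 1))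
    (by simp)

theorem integral_mul_pd {φ g : E3 → ℝ} (hφ : ContDiff ℝ (⊤ : ℕ∞) φ) (hs : HasCompactSupport φ)
    (hg : ContDiff ℝ (⊤ : ℕ∞) g) (j : Fin 3) :
    ∫ x, φ x * pd j g x = - ∫ x, pd j φ x * g x := by
  exact integral_mul_fderiv_eq_neg_fderiv_mul_of_integrable
    (((contDiff_pd hφ j).continuous.mul hg.continuous).integrable_of_hasCompactSupport
      (hasCompactSupport_pd hs j).mul_right)
    ((hφ.continuous.mul (contDiff_pd hg j).continuous).integrable_of_hasCompactSupport hs.mul_right)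
    ((hφ.continuous.mul hg.continuous).integrable_of_hasCompactSupport hs.mul_right)
    (fun x _ => hφ.differentiable (by simp) x) (fun x _ => hg.differentiable (by simp) x)

theorem integral_mul_div_flux {φ : E3 → ℝ} {M : Fin 3 → Fin 3 → E3 → ℝ} {N : Fin 3 → E3 → ℝ}
    (hφ : ContDiff ℝ (⊤ : ℕ∞) φ) (hs : HasCompactSupport φ)
    (hM : ∀ i j, ContDiff ℝ (⊤ : ℕ∞) (M i j)) (hN : ∀ j, ContDiff ℝ (⊤ : ℕ∞) (N j)) :
    ∫ x, φ x * ∑ j, pd j (fun y => ∑ i, pd i (M i j) y + N j y) x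
      = ∫ x, (∑ j, ∑ i, pd i (pd j φ) x * M i j x - ∑ j, pd j φ x * N j x) := by
  have hg : ∀ j, ContDiff ℝ (⊤ : ℕ∞) (fun y => ∑ i, pd i (M i j) y + N j y) := fun j =>
    (ContDiff.sum fun i _ => contDiff_pd (hM i j) i).add (hN j)
  have hi : ∀ {ψ f : E3 → ℝ}, ContDiff ℝ (⊤ : ℕ∞) ψ → HasCompactSupport ψ →
      ContDiff ℝ (⊤ : ℕ∞) f → Integrable fun x => ψ x * f x := fun h1 h2 h3 =>
    (h1.continuous.mul h3.continuous).integrable_of_hasCompactSupport h2.mul_right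
  have h1 := fun j => contDiff_pd hφ j
  have h2 := fun j => hasCompactSupport_pd hs j
  simp only [Finset.mul_sum]
  rw [integral_finsetSum _ fun j _ => hi hφ hs (contDiff_pd (hg j) j), integral_sub
    (integrable_finsetSum _ fun j _ => integrable_finsetSum _ fun i _ =>
      hi (contDiff_pd (h1 j) i) (hasCompactSupport_pd (h2 j) i) (hM i j))
    (integrable_finsetSum _ fun j _ => hi (h1 j) (h2 j) (hN j)),
    integral_finsetSum _ fun j _ => integrable_finsetSum _ fun i _ =>
      hi (contDiff_pd (h1 j) i) (hasCompactSupport_pd (h2 j) i) (hM i j),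
    integral_finsetSum _ fun j _ => hi (h1 j) (h2 j) (hN j), ← Finset.sum_sub_distrib]
  refine Finset.sum_congr rfl fun j _ => ?_
  rw [integral_mul_pd hφ hs (hg j) j]
  simp only [mul_add, Finset.mul_sum]
  rw [integral_add (integrable_finsetSum _ fun i _ => hi (h1 j) (h2 j) (contDiff_pd (hM i j) i))
    (hi (h1 j) (h2 j) (hN j)),
    integral_finsetSum _ fun i _ => hi (h1 j) (h2 j) (contDiff_pd (hM i j) i),
    integral_finsetSum _ fun i _ =>
      hi (contDiff_pd (h1 j) i) (hasCompactSupport_pd (h2 j) i) (hM i j)]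
  simp only [fun i => integral_mul_pd (h1 j) (h2 j) (hM i j) i, Finset.sum_neg_distrib]
  ring

theorem pd_eq_zero_of_eventuallyEq_const {f : E3 → ℝ} {x : E3} {c : ℝ}
    (h : f =ᶠ[nhds x] fun _ => c) (j : Fin 3) : pd j f x = 0 := by
  simp [pd, h.fderiv_eq]

theorem pd_comp_smul (f : E3 → ℝ) (c : ℝ) (j : Fin 3) (x : E3) :
    pd j (fun y => f (c • y)) x = c * pd j f (c • x) := by
  simp [pd, fderiv_comp_smul]

theorem pd_const_mul (f : E3 → ℝ) (c : ℝ) (j : Fin 3) (x : E3) :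
    pd j (fun y => c * f y) x = c * pd j f x := by
  change fderiv ℝ (c • f) x _ = _
  simp [fderiv_const_smul_field, pd]

theorem exists_abs_le_of_hasCompactSupport {f : E3 → ℝ} (hf : Continuous f)
    (hs : HasCompactSupport f) : ∃ C : ℝ, ∀ x, |f x| ≤ C :=
  hs.exists_bound_of_continuous hf

theorem exists_cutoff : ∃ C : ℝ, 0 ≤ C ∧ ∀ R : ℝ, 0 < R → ∃ φ : E3 → ℝ,
    ContDiff ℝ (⊤ : ℕ∞) φ ∧ HasCompactSupport φ ∧ (∀ x, 0 ≤ φ x) ∧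
    (∀ x, ‖x‖ ≤ R / 2 → φ x = 1) ∧
    (∀ j x, |pd j φ x| ≤ C * R⁻¹) ∧ (∀ i j x, |pd i (pd j φ) x| ≤ C * R⁻¹ ^ 2) ∧
    (∀ x, x ∉ ann R → (∀ j, pd j φ x = 0) ∧ ∀ i j, pd i (pd j φ) x = 0) := by
  let b : ContDiffBump (0 : E3) := ⟨5 / 8, 7 / 8, by norm_num, by norm_num⟩
  have hb : ContDiff ℝ (⊤ : ℕ∞) (b : E3 → ℝ) := b.contDiff
  have h1 := fun j => contDiff_pd hb j
  have h2 := fun i j => contDiff_pd (h1 j) i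
  have s1 := fun j => hasCompactSupport_pd b.hasCompactSupport j
  have s2 := fun i j => hasCompactSupport_pd (s1 j) i
  choose C1 hC1 using fun j => exists_abs_le_of_hasCompactSupport (h1 j).continuous (s1 j)
  choose C2 hC2 using fun i j => exists_abs_le_of_hasCompactSupport (h2 i j).continuous (s2 i j)
  have p1 : ∀ j, 0 ≤ C1 j := fun j => (abs_nonneg _).trans (hC1 j 0)
  have p2 : ∀ i j, 0 ≤ C2 i j := fun i j => (abs_nonneg _).trans (hC2 i j 0)
  have q1 : 0 ≤ ∑ j, C1 j := Finset.sum_nonneg fun j _ => p1 j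
  have q2 : 0 ≤ ∑ i, ∑ j, C2 i j := Finset.sum_nonneg fun i _ => Finset.sum_nonneg fun j _ => p2 i j
  refine ⟨∑ j, C1 j + ∑ i, ∑ j, C2 i j, by positivity, fun R hR => ?_⟩
  have hR' : 0 < R⁻¹ := by positivity
  have e1 : ∀ j, pd j (fun x => b (R⁻¹ • x)) = fun x => R⁻¹ * pd j b (R⁻¹ • x) := fun j =>
    funext fun x => pd_comp_smul _ _ _ _
  have e2 : ∀ i j x, pd i (pd j (fun x => b (R⁻¹ • x))) x = R⁻¹ ^ 2 * pd i (pd j b) (R⁻¹ • x) := by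
    intro i j x
    rw [e1, pd_const_mul, pd_comp_smul]
    ring
  have hcs : Continuous fun x : E3 => ‖R⁻¹ • x‖ := by fun_prop
  have hloc : ∀ x, x ∉ ann R → ∃ c : ℝ, (fun y => b (R⁻¹ • y)) =ᶠ[nhds x] fun _ => c := by
    intro x hx
    have hx' : R / 2 < ‖x‖ → R ≤ ‖x‖ := by
      intro h
      by_contra h'
      exact hx ⟨h, lt_of_not_ge h'⟩
    have hn : ‖R⁻¹ • x‖ = R⁻¹ * ‖x‖ := by rw [norm_smul, Real.norm_of_nonneg hR'.le]
    rcases le_or_gt ‖x‖ (R / 2) with h | h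
    · refine ⟨1, ?_⟩
      have : ‖R⁻¹ • x‖ < 5 / 8 := by
        rw [hn, inv_mul_lt_iff₀ hR]
        linarith
      filter_upwards [hcs.continuousAt.eventually_lt_const this] with y hy
      exact b.one_of_mem_closedBall (by simpa using hy.le)
    · refine ⟨0, ?_⟩
      have : 7 / 8 < ‖R⁻¹ • x‖ := by
        rw [hn, lt_inv_mul_iff₀ hR]
        linarith [hx' h]
      filter_upwards [hcs.continuousAt.eventually_const_lt this] with y hy
      exact b.zero_of_le_dist (by simpa using hy.le)
  refine ⟨fun x => b (R⁻¹ • x), by fun_prop, ?_, fun x => b.nonneg, ?_, ?_, ?_, ?_⟩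
  · exact b.hasCompactSupport.comp_smul hR'.ne'
  · intro x hx
    refine b.one_of_mem_closedBall ?_
    simp only [mem_closedBall, dist_zero_right, norm_smul, Real.norm_of_nonneg hR'.le]
    rw [inv_mul_le_iff₀ hR]
    change ‖x‖ ≤ R * (5 / 8)
    linarith
  · intro j x
    rw [e1, abs_mul, abs_of_pos hR', mul_comm]
    gcongr
    exact (hC1 j _).trans
      ((Finset.single_le_sum (fun j _ => p1 j) (Finset.mem_univ j)).trans (by linarith))
  · intro i j x
    rw [e2, abs_mul, abs_of_pos (by positivity), mul_comm]
    gcongr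
    refine (hC2 i j _).trans ((Finset.single_le_sum (fun j _ => p2 i j) (Finset.mem_univ j)).trans ?_)
    refine (Finset.single_le_sum (f := fun i => ∑ j, C2 i j)
      (fun i _ => Finset.sum_nonneg fun j _ => p2 i j) (Finset.mem_univ i)).trans (by linarith)
  · intro x hx
    obtain ⟨c, hc⟩ := hloc x hx
    refine ⟨fun j => pd_eq_zero_of_eventuallyEq_const hc j, fun i j => ?_⟩
    refine pd_eq_zero_of_eventuallyEq_const (c := 0) ?_ i
    filter_upwards [hc.eventuallyEq_nhds] with y hy
    exact pd_eq_zero_of_eventuallyEq_const hy j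

/-- The quantity `|u|² + |∇v|² + |P|`. -/
def quadSum (u v : E3 → Fin 3 → ℝ) (P : E3 → ℝ) (x : E3) : ℝ :=
  ∑ l, u x l ^ 2 + gradSq v x + |P x|

theorem abs_fluxM_le (u v : E3 → Fin 3 → ℝ) (P : E3 → ℝ) (i j : Fin 3) (x : E3) :
    |fluxM u v i j x| ≤ 3 * quadSum u v P x := by
  have hP := abs_nonneg (P x)
  have hu : 0 ≤ ∑ l, u x l ^ 2 := by positivity
  have hv : 0 ≤ gradSq v x := by unfold gradSq; positivity
  have hrow : ∀ i, ∑ k, pd i (fun y => v y k) x ^ 2 ≤ gradSq v x := fun i =>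
    Finset.single_le_sum (f := fun i => ∑ k, pd i (fun y => v y k) x ^ 2)
      (fun _ _ => by positivity) (Finset.mem_univ i)
  have h2 : |2 * ∑ k, pd i (fun y => v y k) x * pd j (fun y => v y k) x| ≤ 2 * gradSq v x := by
    rw [Finset.mul_sum]
    refine (Finset.abs_sum_le_sum_abs _ _).trans ?_
    have : ∑ k, |2 * (pd i (fun y => v y k) x * pd j (fun y => v y k) x)|
        ≤ ∑ k, (pd i (fun y => v y k) x ^ 2 + pd j (fun y => v y k) x ^ 2) := by
      refine Finset.sum_le_sum fun k _ => ?_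
      rw [abs_le]
      constructor
      · nlinarith [sq_nonneg (pd i (fun y => v y k) x + pd j (fun y => v y k) x)]
      · nlinarith [sq_nonneg (pd i (fun y => v y k) x - pd j (fun y => v y k) x)]
    rw [Finset.sum_add_distrib] at this
    linarith [hrow i, hrow j]
  have h1 : |if i = j then ∑ l, u x l ^ 2 - gradSq v x else 0| ≤ ∑ l, u x l ^ 2 + gradSq v x := by
    split_ifs
    · rw [abs_le]; constructor <;> linarith
    · simp; linarith
  unfold quadSum fluxM
  refine (abs_add_le _ _).trans ?_
  linarith

theorem abs_le_vecNorm (u : E3 → Fin 3 → ℝ) (x : E3) (i : Fin 3) : |u x i| ≤ vecNorm u x :=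
  Real.abs_le_sqrt (Finset.single_le_sum (f := fun i => u x i ^ 2) (fun _ _ => sq_nonneg _)
    (Finset.mem_univ i))

theorem abs_fluxN_le (u v : E3 → Fin 3 → ℝ) (P : E3 → ℝ) (j : Fin 3) (x : E3) :
    |fluxN u v P j x| ≤ 6 * (vecNorm u x * quadSum u v P x) := by
  have hP := abs_nonneg (P x)
  have ha : 0 ≤ vecNorm u x := Real.sqrt_nonneg _
  have hu : 0 ≤ ∑ l, u x l ^ 2 := by positivity
  have hv : 0 ≤ gradSq v x := by unfold gradSq; positivity
  have h1 : |u x j * (∑ l, u x l ^ 2 + 2 * P x + gradSq v x)|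
      ≤ vecNorm u x * (2 * quadSum u v P x) := by
    rw [abs_mul]
    refine mul_le_mul (abs_le_vecNorm u x j) ?_ (abs_nonneg _) ha
    unfold quadSum
    rw [abs_le]
    constructor <;> cases abs_cases (P x) <;> linarith
  have h2 : |2 * ∑ i, ∑ k, pd j (fun y => v y k) x * u x i * pd i (fun y => v y k) x|
      ≤ vecNorm u x * (4 * quadSum u v P x) := by
    have hrow : ∑ k, pd j (fun y => v y k) x ^ 2 ≤ gradSq v x :=
      Finset.single_le_sum (f := fun i => ∑ k, pd i (fun y => v y k) x ^ 2)
        (fun _ _ => by positivity) (Finset.mem_univ j)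
    have hpt : ∀ i k, |2 * (pd j (fun y => v y k) x * u x i * pd i (fun y => v y k) x)|
        ≤ vecNorm u x * (pd j (fun y => v y k) x ^ 2 + pd i (fun y => v y k) x ^ 2) := by
      intro i k
      have e : 2 * (pd j (fun y => v y k) x * u x i * pd i (fun y => v y k) x)
        = u x i * (2 * (pd j (fun y => v y k) x * pd i (fun y => v y k) x)) := by ring
      rw [e, abs_mul]
      refine mul_le_mul (abs_le_vecNorm u x i) ?_ (abs_nonneg _) ha
      rw [abs_le]
      constructor
      · nlinarith [sq_nonneg (pd i (fun y => v y k) x + pd j (fun y => v y k) x)]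
      · nlinarith [sq_nonneg (pd i (fun y => v y k) x - pd j (fun y => v y k) x)]
    simp only [Finset.mul_sum]
    calc _ ≤ ∑ i, ∑ k, |2 * (pd j (fun y => v y k) x * u x i * pd i (fun y => v y k) x)| :=
          (Finset.abs_sum_le_sum_abs _ _).trans
            (Finset.sum_le_sum fun i _ => Finset.abs_sum_le_sum_abs _ _)
      _ ≤ ∑ i, ∑ k, vecNorm u x * (pd j (fun y => v y k) x ^ 2 + pd i (fun y => v y k) x ^ 2) :=
          Finset.sum_le_sum fun i _ => Finset.sum_le_sum fun k _ => hpt i k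
      _ = vecNorm u x * (3 * ∑ k, pd j (fun y => v y k) x ^ 2 + gradSq v x) := by
          simp only [← Finset.mul_sum, Finset.sum_add_distrib, gradSq]
          simp
      _ ≤ _ := by
          refine mul_le_mul_of_nonneg_left ?_ ha
          unfold quadSum
          linarith
  unfold fluxN
  refine (abs_sub _ _).trans ?_
  rw [abs_neg]
  linarith

theorem mul_le_young {p ε a w : ℝ} (hp : 3 ≤ p) (hε : 0 < ε) (ha : 0 ≤ a) (hw : 0 ≤ w) :
    a * w ≤ ε * (1 + w ^ (p / 2)) + ε * (a / ε) ^ p := by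
  have hwp : 0 ≤ w ^ (p / 2) := Real.rpow_nonneg hw _
  have hap : 0 ≤ (a / ε) ^ p := Real.rpow_nonneg (by positivity) _
  have hw1 : w ≤ 1 + w ^ (p / 2) := by
    rcases le_total w 1 with h | h
    · linarith
    · linarith [Real.self_le_rpow_of_one_le h (by linarith : 1 ≤ p / 2)]
  rcases le_or_gt a ε with h | h
  · nlinarith [mul_le_mul_of_nonneg_right h hw, mul_le_mul_of_nonneg_left hw1 hε.le,
      mul_nonneg hε.le hap]
  have hb : 1 < a / ε := by rwa [one_lt_div hε]
  have hae : a = ε * (a / ε) := by field_simp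
  rcases le_total ((a / ε) ^ 2) w with h2 | h2
  · have hw1' : 1 ≤ w := le_trans (by nlinarith) h2
    have h3 : a / ε ≤ w ^ (p / 2 - 1) :=
      calc a / ε ≤ Real.sqrt w := Real.le_sqrt_of_sq_le h2
        _ = w ^ (1 / 2 : ℝ) := Real.sqrt_eq_rpow w
        _ ≤ w ^ (p / 2 - 1) := Real.rpow_le_rpow_of_exponent_le hw1' (by linarith)
    have h4 : w ^ (p / 2) = w ^ (p / 2 - 1) * w := by
      rw [← Real.rpow_add_one (by linarith), sub_add_cancel]
    have h5 : a * w ≤ ε * w ^ (p / 2) := by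
      rw [h4, hae, mul_assoc]
      gcongr
    nlinarith [mul_nonneg hε.le hap]
  · have h3 : (a / ε) ^ 3 ≤ (a / ε) ^ p := by
      rw [← Real.rpow_natCast]
      exact Real.rpow_le_rpow_of_exponent_le hb.le (by exact_mod_cast hp)
    have h5 : a * w ≤ ε * (a / ε) ^ p :=
      calc a * w ≤ a * (a / ε) ^ 2 := by gcongr
        _ = ε * (a / ε) ^ 3 := by
          nth_rewrite 1 [hae]
          ring
        _ ≤ _ := by gcongr
    nlinarith [mul_nonneg hε.le hwp]

theorem scaled_young {γ p ε a w R : ℝ} (hp : 3 ≤ p) (hη : γ / p - 3 / p + 2 / 3 ≤ 0)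
    (hε : 0 < ε) (hR : 1 ≤ R) (hRε : R ^ (-(1 / 3) : ℝ) ≤ ε) (ha : 0 ≤ a) (hw : 0 ≤ w) :
    R⁻¹ ^ 2 * w + R⁻¹ * (a * w)
      ≤ 2 * ε * (R⁻¹ ^ 3 + R ^ (-γ) * w ^ (p / 2)) + ε * (ε⁻¹) ^ p * (R ^ (-γ) * a ^ p) := by
  have hR0 : 0 < R := by linarith
  have hp0 : p ≠ 0 := by linarith
  set β : ℝ := γ / p - 3 / p with hβ
  have hβp : β * p = γ - 3 := by rw [hβ]; field_simp
  set α : ℝ := R ^ β with hα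
  have hα0 : 0 < α := Real.rpow_pos_of_pos hR0 _
  have hαp : α ^ p = R ^ (γ - 3) := by rw [hα, ← Real.rpow_mul hR0.le, hβp]
  have hα2p : (α ^ 2) ^ (p / 2) = R ^ (γ - 3) := by
    rw [← Real.rpow_natCast, ← Real.rpow_mul hα0.le, ← hαp]
    congr 1
    push_cast
    ring
  have hsplit : R⁻¹ ^ 3 * (R ^ (γ - 3))⁻¹ = R ^ (-γ) := by
    rw [← Real.rpow_neg hR0.le, inv_pow, ← Real.rpow_natCast, ← Real.rpow_neg hR0.le,
      ← Real.rpow_add hR0]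
    congr 1
    push_cast
    ring
  have hawp : 0 ≤ w / α ^ 2 := by positivity
  have hw' : R⁻¹ ^ 3 * (w / α ^ 2) ^ (p / 2) = R ^ (-γ) * w ^ (p / 2) := by
    rw [Real.div_rpow hw (by positivity), hα2p, ← hsplit]
    ring
  have ha' : R⁻¹ ^ 3 * (ε * (a / α / ε) ^ p) = ε * (ε⁻¹) ^ p * (R ^ (-γ) * a ^ p) := by
    rw [Real.div_rpow (by positivity) hε.le, Real.div_rpow ha hα0.le, hαp, ← hsplit,
      Real.inv_rpow hε.le]
    ring
  have hα3 : R⁻¹ * α ^ 3 ≤ R⁻¹ ^ 3 := by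
    have : α ^ 3 ≤ R⁻¹ ^ 2 := by
      rw [hα, inv_pow, ← Real.rpow_natCast, ← Real.rpow_natCast, ← Real.rpow_mul hR0.le,
        ← Real.rpow_neg hR0.le]
      refine Real.rpow_le_rpow_of_exponent_le hR ?_
      push_cast
      linarith
    calc R⁻¹ * α ^ 3 ≤ R⁻¹ * R⁻¹ ^ 2 := by gcongr
      _ = R⁻¹ ^ 3 := by ring
  have hα2 : R⁻¹ ^ 2 * α ^ 2 ≤ ε * R⁻¹ ^ 3 := by
    have : α ^ 2 ≤ R ^ (-(1 / 3) : ℝ) * R⁻¹ := by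
      rw [hα, ← Real.rpow_natCast, ← Real.rpow_mul hR0.le, ← Real.rpow_neg_one,
        ← Real.rpow_add hR0]
      refine Real.rpow_le_rpow_of_exponent_le hR ?_
      push_cast
      linarith
    calc R⁻¹ ^ 2 * α ^ 2 ≤ R⁻¹ ^ 2 * (ε * R⁻¹) := by
          gcongr
          exact this.trans (by gcongr)
      _ = ε * R⁻¹ ^ 3 := by ring
  have hw1 : w / α ^ 2 ≤ 1 + (w / α ^ 2) ^ (p / 2) := by
    have := Real.rpow_nonneg hawp (p / 2)
    rcases le_total (w / α ^ 2) 1 with h | h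
    · linarith
    · linarith [Real.self_le_rpow_of_one_le h (by linarith : 1 ≤ p / 2)]
  have hy := mul_le_young hp hε (by positivity : 0 ≤ a / α) hawp
  have t1 : R⁻¹ ^ 2 * w ≤ ε * (R⁻¹ ^ 3 + R ^ (-γ) * w ^ (p / 2)) :=
    calc R⁻¹ ^ 2 * w = R⁻¹ ^ 2 * α ^ 2 * (w / α ^ 2) := by field_simp
      _ ≤ ε * R⁻¹ ^ 3 * (1 + (w / α ^ 2) ^ (p / 2)) := by gcongr
      _ = ε * (R⁻¹ ^ 3 + R⁻¹ ^ 3 * (w / α ^ 2) ^ (p / 2)) := by ring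
      _ = _ := by rw [hw']
  have t2 : R⁻¹ * (a * w) ≤ ε * (R⁻¹ ^ 3 + R ^ (-γ) * w ^ (p / 2))
      + ε * (ε⁻¹) ^ p * (R ^ (-γ) * a ^ p) :=
    calc R⁻¹ * (a * w) = R⁻¹ * α ^ 3 * (a / α * (w / α ^ 2)) := by field_simp
      _ ≤ R⁻¹ ^ 3 * (ε * (1 + (w / α ^ 2) ^ (p / 2)) + ε * (a / α / ε) ^ p) := by gcongr
      _ = ε * (R⁻¹ ^ 3 + R⁻¹ ^ 3 * (w / α ^ 2) ^ (p / 2)) + R⁻¹ ^ 3 * (ε * (a / α / ε) ^ p) := by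
        ring
      _ = _ := by rw [hw', ha']
  linarith

theorem ann_subset_ball (R : ℝ) : ann R ⊆ ball (0 : E3) R := fun x hx => by simpa using hx.2

theorem integrableOn_Icc_prod {F : ℝ × E3 → ℝ} (hF : Continuous F) (T R : ℝ) {S : Set E3}
    (hS : S ⊆ ball (0 : E3) R) : IntegrableOn F (Set.Icc 0 T ×ˢ S) :=
  (hF.continuousOn.integrableOn_compact (isCompact_Icc.prod (isCompact_closedBall (0 : E3) R))).mono_set
    (Set.prod_mono subset_rfl (hS.trans ball_subset_closedBall))

theorem setIntegral_Icc_prod {F : ℝ × E3 → ℝ} (hF : Continuous F) (T R : ℝ) {S : Set E3}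
    (hS : S ⊆ ball (0 : E3) R) :
    ∫ q in Set.Icc 0 T ×ˢ S, F q = ∫ t in Set.Icc (0 : ℝ) T, ∫ x in S, F (t, x) :=
  setIntegral_prod F (integrableOn_Icc_prod hF T R hS)

theorem setIntegral_one_le {T R : ℝ} (hT : 0 < T) (hR : 1 ≤ R) :
    R⁻¹ ^ 3 * ∫ _ in Set.Icc 0 T ×ˢ ann R, (1 : ℝ) ∂(volume : Measure (ℝ × E3))
      ≤ T * volume.real (ball (0 : E3) 1) := by
  have h1 : ∫ _ in Set.Icc 0 T ×ˢ ann R, (1 : ℝ) ∂(volume : Measure (ℝ × E3))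
      = T * volume.real (ann R) := by
    rw [setIntegral_const, smul_eq_mul, mul_one, Measure.volume_eq_prod, measureReal_prod_prod]
    simp [hT.le]
  have h2 : volume.real (ann R) ≤ R ^ 3 * volume.real (ball (0 : E3) 1) := by
    refine (measureReal_mono (ann_subset_ball R) measure_ball_lt_top.ne).trans ?_
    rw [measureReal_def, Measure.addHaar_ball volume (0 : E3) (by linarith : 0 ≤ R)]
    simp [measureReal_def, ENNReal.toReal_ofReal (by positivity : 0 ≤ R ^ 3)]
  rw [h1]
  calc R⁻¹ ^ 3 * (T * volume.real (ann R))
      ≤ R⁻¹ ^ 3 * (T * (R ^ 3 * volume.real (ball (0 : E3) 1))) := by gcongr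
    _ = _ := by
      have : R ≠ 0 := by linarith
      field_simp

theorem tendsto_annular_remainder {γ p T : ℝ} (hT : 0 < T) (hp : 3 ≤ p)
    (hη : γ / p - 3 / p + 2 / 3 ≤ 0) {a w : ℝ × E3 → ℝ} (hac : Continuous a) (hwc : Continuous w)
    (ha : ∀ q, 0 ≤ a q) (hw : ∀ q, 0 ≤ w q)
    (ham : Tendsto (fun R : ℝ => R ^ (-γ) * ∫ q in Set.Icc 0 T ×ˢ ann R, a q ^ p) atTop (nhds 0))
    (hwm : ∃ C : ℝ, ∀ R : ℝ, 1 ≤ R →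
      R ^ (-γ) * ∫ q in Set.Icc 0 T ×ˢ ball (0 : E3) R, w q ^ (p / 2) ≤ C) :
    Tendsto (fun R : ℝ => ∫ q in Set.Icc 0 T ×ˢ ann R, (R⁻¹ ^ 2 * w q + R⁻¹ * (a q * w q)))
      atTop (nhds 0) := by
  obtain ⟨C, hC⟩ := hwm
  set V := T * volume.real (ball (0 : E3) 1) with hV
  have hV0 : 0 ≤ V := by positivity
  have hapc : Continuous fun q => a q ^ p := hac.rpow_const fun _ => Or.inr (by linarith)
  have hwpc : Continuous fun q => w q ^ (p / 2) := hwc.rpow_const fun _ => Or.inr (by linarith)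
  have hbound : ∀ ε : ℝ, 0 < ε → ∀ R : ℝ, 1 ≤ R → R ^ (-(1 / 3) : ℝ) ≤ ε →
      ∫ q in Set.Icc 0 T ×ˢ ann R, (R⁻¹ ^ 2 * w q + R⁻¹ * (a q * w q))
        ≤ 2 * ε * (V + C)
          + ε * (ε⁻¹) ^ p * (R ^ (-γ) * ∫ q in Set.Icc 0 T ×ˢ ann R, a q ^ p) := by
    intro ε hε R hR hRε
    have hi : ∀ {F : ℝ × E3 → ℝ}, Continuous F → IntegrableOn F (Set.Icc 0 T ×ˢ ann R) :=
      fun hF => integrableOn_Icc_prod hF T R (ann_subset_ball R)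
    have hγR : 0 ≤ R ^ (-γ) := Real.rpow_nonneg (by linarith) _
    calc ∫ q in Set.Icc 0 T ×ˢ ann R, (R⁻¹ ^ 2 * w q + R⁻¹ * (a q * w q))
        ≤ ∫ q in Set.Icc 0 T ×ˢ ann R, (2 * ε * (R⁻¹ ^ 3 * 1 + R ^ (-γ) * w q ^ (p / 2))
            + ε * (ε⁻¹) ^ p * (R ^ (-γ) * a q ^ p)) := by
          refine setIntegral_mono (hi (by fun_prop)) (hi (by fun_prop)) fun q => ?_
          rw [mul_one]
          exact scaled_young hp hη hε hR hRε (ha q) (hw q)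
      _ = 2 * ε * (R⁻¹ ^ 3 * (∫ _ in Set.Icc 0 T ×ˢ ann R, (1 : ℝ) ∂(volume : Measure (ℝ × E3)))
            + R ^ (-γ) * ∫ q in Set.Icc 0 T ×ˢ ann R, w q ^ (p / 2))
          + ε * (ε⁻¹) ^ p * (R ^ (-γ) * ∫ q in Set.Icc 0 T ×ˢ ann R, a q ^ p) := by
          rw [integral_add (hi (by fun_prop)) (hi (by fun_prop)), integral_const_mul,
            integral_add (hi (by fun_prop)) (hi (by fun_prop)), integral_const_mul,
            integral_const_mul, integral_const_mul, integral_const_mul]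
      _ ≤ _ := by
          have h1 := setIntegral_one_le hT hR
          have h2 : R ^ (-γ) * ∫ q in Set.Icc 0 T ×ˢ ann R, w q ^ (p / 2) ≤ C := by
            refine le_trans (mul_le_mul_of_nonneg_left ?_ hγR) (hC R hR)
            exact setIntegral_mono_set (integrableOn_Icc_prod hwpc T R subset_rfl)
              (ae_of_all _ fun q => Real.rpow_nonneg (hw q) _)
              (Set.prod_mono subset_rfl (ann_subset_ball R)).eventuallyLE
          gcongr
  have hVC : 0 ≤ V + C := by
    have : 0 ≤ C := le_trans (mul_nonneg (Real.rpow_nonneg zero_le_one _)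
      (integral_nonneg fun q => Real.rpow_nonneg (hw q) _)) (hC 1 le_rfl)
    linarith
  rw [Metric.tendsto_atTop']
  intro δ hδ
  set ε := δ / (4 * (V + C) + 1) with hεd
  have hε : 0 < ε := by positivity
  have hεδ : 2 * ε * (V + C) < δ / 2 := by
    have : ε * (4 * (V + C) + 1) = δ := by rw [hεd]; field_simp
    nlinarith
  have hlim := (ham.const_mul (ε * (ε⁻¹) ^ p)).eventually_lt_const (u := δ / 2)
    (by simpa using half_pos hδ)
  have hR3 := (tendsto_rpow_neg_atTop (by norm_num : (0 : ℝ) < 1 / 3)).eventually_lt_const hε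
  obtain ⟨N, hN⟩ := eventually_atTop.1 (hlim.and (hR3.and (eventually_ge_atTop 1)))
  refine ⟨N, fun R hR => ?_⟩
  obtain ⟨h1, h2, h3⟩ := hN R hR.le
  have hR0 : 0 < R := by linarith
  rw [Real.dist_eq, sub_zero, abs_of_nonneg (integral_nonneg fun q => by
    have := ha q
    have := hw q
    positivity)]
  linarith [hbound ε hε R h3 h2.le]

theorem contDiff_slice {F : ℝ × E3 → ℝ} (hF : ContDiff ℝ (⊤ : ℕ∞) F) (t : ℝ) :
    ContDiff ℝ (⊤ : ℕ∞) fun x => F (t, x) :=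
  hF.comp (contDiff_const.prodMk contDiff_id)

theorem hasDerivAt_time {F : ℝ × E3 → ℝ} (hF : ContDiff ℝ (⊤ : ℕ∞) F) (t : ℝ) (x : E3) :
    HasDerivAt (fun s => F (s, x)) (fderiv ℝ F (t, x) (1, 0)) t :=
  ((hF.differentiable (by simp) (t, x)).hasFDerivAt.comp_hasDerivAt t
    ((hasDerivAt_id t).prodMk (hasDerivAt_const t x)))

theorem pd_slice_eq {F : ℝ × E3 → ℝ} (hF : ContDiff ℝ (⊤ : ℕ∞) F) (j : Fin 3) (t : ℝ) (x : E3) :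
    pd j (fun y => F (t, y)) x = fderiv ℝ F (t, x) (0, EuclideanSpace.single j 1) := by
  have h : HasFDerivAt (fun y => F (t, y)) _ x :=
    (hF.differentiable (by simp) (t, x)).hasFDerivAt.comp x
      ((hasFDerivAt_const t x).prodMk (hasFDerivAt_id x))
  simp [pd, h.fderiv]

theorem contDiff_fderiv_apply_const {F : ℝ × E3 → ℝ} (hF : ContDiff ℝ (⊤ : ℕ∞) F) (a : ℝ × E3) :
    ContDiff ℝ (⊤ : ℕ∞) fun q => fderiv ℝ F q a :=
  (hF.fderiv_right (m := (⊤ : ℕ∞)) (by simp)).clm_apply contDiff_const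

theorem contDiff_pd_slice {F : ℝ × E3 → ℝ} (hF : ContDiff ℝ (⊤ : ℕ∞) F) (j : Fin 3) :
    ContDiff ℝ (⊤ : ℕ∞) fun q : ℝ × E3 => pd j (fun y => F (q.1, y)) q.2 := by
  simp only [pd_slice_eq hF]
  exact contDiff_fderiv_apply_const hF _

theorem contDiff_deriv_slice {F : ℝ × E3 → ℝ} (hF : ContDiff ℝ (⊤ : ℕ∞) F) :
    ContDiff ℝ (⊤ : ℕ∞) fun q : ℝ × E3 => deriv (fun s => F (s, q.2)) q.1 := by
  simp only [fun t x => (hasDerivAt_time hF t x).deriv]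
  exact contDiff_fderiv_apply_const hF _

theorem hasDerivAt_pd_slice {F : ℝ × E3 → ℝ} (hF : ContDiff ℝ (⊤ : ℕ∞) F) (j : Fin 3) (t : ℝ)
    (x : E3) : HasDerivAt (fun s => pd j (fun y => F (s, y)) x)
      (pd j (fun y => deriv (fun s => F (s, y)) t) x) t := by
  have h1 := pd_slice_eq (contDiff_deriv_slice hF) j t x
  have h2 := hasDerivAt_time (contDiff_pd_slice hF j) t x
  simp only [fun t x => (hasDerivAt_time hF t x).deriv, pd_slice_eq hF] at h1 h2 ⊢
  rw [h1, fderiv_fderiv_apply_comm hF]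
  exact h2

/-- The density `|u|² + |∇v|²`. -/
def energy (u v : ℝ → E3 → Fin 3 → ℝ) (t : ℝ) (x : E3) : ℝ :=
  ∑ i, u t x i ^ 2 + gradSq (v t) x

/-- The formal time derivative of `energy`. -/
def energyRate (u v : ℝ → E3 → Fin 3 → ℝ) (t : ℝ) (x : E3) : ℝ :=
  2 * (∑ i, u t x i * deriv (fun s => u s x i) t
    + ∑ j, ∑ k, pd j (fun y => v t y k) x * pd j (fun y => deriv (fun s => v s y k) t) x)

theorem continuous_energy {u v : ℝ → E3 → Fin 3 → ℝ}
    (hu : ∀ i, ContDiff ℝ (⊤ : ℕ∞) fun q : ℝ × E3 => u q.1 q.2 i)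
    (hv : ∀ i, ContDiff ℝ (⊤ : ℕ∞) fun q : ℝ × E3 => v q.1 q.2 i) :
    Continuous fun q : ℝ × E3 => energy u v q.1 q.2 := by
  have h1 := fun i => (hu i).continuous
  have h2 := fun i j => (contDiff_pd_slice (hv i) j).continuous
  unfold energy gradSq
  exact (continuous_finsetSum _ fun i _ => (h1 i).pow 2).add
    (continuous_finsetSum _ fun j _ => continuous_finsetSum _ fun i _ => (h2 i j).pow 2)

theorem continuous_energyRate {u v : ℝ → E3 → Fin 3 → ℝ}
    (hu : ∀ i, ContDiff ℝ (⊤ : ℕ∞) fun q : ℝ × E3 => u q.1 q.2 i)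
    (hv : ∀ i, ContDiff ℝ (⊤ : ℕ∞) fun q : ℝ × E3 => v q.1 q.2 i) :
    Continuous fun q : ℝ × E3 => energyRate u v q.1 q.2 := by
  have h1 := fun i => (hu i).continuous
  have h2 := fun i j => (contDiff_pd_slice (hv i) j).continuous
  have h3 := fun i => (contDiff_deriv_slice (hu i)).continuous
  have h4 := fun i j => (contDiff_pd_slice (contDiff_deriv_slice (hv i)) j).continuous
  unfold energyRate
  exact continuous_const.mul ((continuous_finsetSum _ fun i _ => (h1 i).mul (h3 i)).add
    (continuous_finsetSum _ fun j _ => continuous_finsetSum _ fun i _ => (h2 i j).mul (h4 i j)))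

theorem hasDerivAt_energy {u v : ℝ → E3 → Fin 3 → ℝ}
    (hu : ∀ i, ContDiff ℝ (⊤ : ℕ∞) fun q : ℝ × E3 => u q.1 q.2 i)
    (hv : ∀ i, ContDiff ℝ (⊤ : ℕ∞) fun q : ℝ × E3 => v q.1 q.2 i)
    (t : ℝ) (x : E3) :
    HasDerivAt (fun s => energy u v s x) (energyRate u v t x) t := by
  have h1 := fun i => (hasDerivAt_time (hu i) t x).differentiableAt.hasDerivAt.fun_pow 2
  have h2 := fun i j => (hasDerivAt_pd_slice (hv i) j t x).fun_pow 2
  have := (HasDerivAt.fun_sum (u := Finset.univ) fun i _ => h1 i).fun_add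
    (HasDerivAt.fun_sum (u := Finset.univ) fun j _ =>
      HasDerivAt.fun_sum (u := Finset.univ) fun i _ => h2 i j)
  refine this.congr_deriv ?_
  simp [energyRate, Finset.mul_sum, mul_add, mul_assoc]

theorem continuous_quadSum {u v : ℝ → E3 → Fin 3 → ℝ} {P : ℝ → E3 → ℝ}
    (hu : ∀ i, ContDiff ℝ (⊤ : ℕ∞) fun q : ℝ × E3 => u q.1 q.2 i)
    (hv : ∀ i, ContDiff ℝ (⊤ : ℕ∞) fun q : ℝ × E3 => v q.1 q.2 i)
    (hP : ContDiff ℝ (⊤ : ℕ∞) fun q : ℝ × E3 => P q.1 q.2) :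
    Continuous fun q : ℝ × E3 => quadSum (u q.1) (v q.1) (P q.1) q.2 :=
  (continuous_energy hu hv).add hP.continuous.abs

theorem continuous_vecNorm {u : ℝ → E3 → Fin 3 → ℝ}
    (hu : ∀ i, ContDiff ℝ (⊤ : ℕ∞) fun q : ℝ × E3 => u q.1 q.2 i) :
    Continuous fun q : ℝ × E3 => vecNorm (u q.1) q.2 :=
  Real.continuous_sqrt.comp (continuous_finsetSum _ fun i _ => (hu i).continuous.pow 2)

theorem contDiff_gradSq {v : E3 → Fin 3 → ℝ} (hv : ∀ i, ContDiff ℝ (⊤ : ℕ∞) fun x => v x i) :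
    ContDiff ℝ (⊤ : ℕ∞) (gradSq v) :=
  ContDiff.sum fun i _ => ContDiff.sum fun k _ => (contDiff_pd (hv k) i).pow 2

theorem contDiff_fluxM {u v : E3 → Fin 3 → ℝ} (hu : ∀ i, ContDiff ℝ (⊤ : ℕ∞) fun x => u x i)
    (hv : ∀ i, ContDiff ℝ (⊤ : ℕ∞) fun x => v x i) (i j : Fin 3) :
    ContDiff ℝ (⊤ : ℕ∞) (fluxM u v i j) := by
  have h1 := fun i j => contDiff_pd (hv i) j
  have h2 : ContDiff ℝ (⊤ : ℕ∞) fun x => ∑ k, pd i (fun y => v y k) x * pd j (fun y => v y k) x :=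
    ContDiff.sum fun k _ => (h1 k i).mul (h1 k j)
  have h3 : ContDiff ℝ (⊤ : ℕ∞) fun x => if i = j then ∑ l, u x l ^ 2 - gradSq v x else 0 := by
    split_ifs
    · exact (ContDiff.sum fun l _ => (hu l).pow 2).sub (contDiff_gradSq hv)
    · exact contDiff_const
  exact h3.add (contDiff_const.mul h2)

theorem contDiff_fluxN {u v : E3 → Fin 3 → ℝ} {P : E3 → ℝ}
    (hu : ∀ i, ContDiff ℝ (⊤ : ℕ∞) fun x => u x i)
    (hv : ∀ i, ContDiff ℝ (⊤ : ℕ∞) fun x => v x i) (hP : ContDiff ℝ (⊤ : ℕ∞) P) (j : Fin 3) :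
    ContDiff ℝ (⊤ : ℕ∞) (fluxN u v P j) := by
  have h1 := fun i j => contDiff_pd (hv i) j
  exact (((hu j).mul (((ContDiff.sum fun l _ => (hu l).pow 2).add (contDiff_const.mul hP)).add
    (contDiff_gradSq hv))).neg).sub (contDiff_const.mul (ContDiff.sum fun i _ =>
      ContDiff.sum fun k _ => ((h1 k j).mul (hu i)).mul (h1 k i)))

theorem abs_flux_pairing_le {φ : E3 → ℝ} {u v : E3 → Fin 3 → ℝ} {P : E3 → ℝ} {C r : ℝ} {x : E3}
    (h1 : ∀ j, |pd j φ x| ≤ C * r) (h2 : ∀ i j, |pd i (pd j φ) x| ≤ C * r ^ 2) :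
    |∑ j, ∑ i, pd i (pd j φ) x * fluxM u v i j x - ∑ j, pd j φ x * fluxN u v P j x|
      ≤ 27 * C * (r ^ 2 * quadSum u v P x + r * (vecNorm u x * quadSum u v P x)) := by
  have hC2 : 0 ≤ C * r ^ 2 := (abs_nonneg _).trans (h2 0 0)
  have hC1 : 0 ≤ C * r := (abs_nonneg _).trans (h1 0)
  have hq : 0 ≤ quadSum u v P x := by unfold quadSum gradSq; positivity
  have ha : 0 ≤ vecNorm u x := Real.sqrt_nonneg _
  have t1 : |∑ j, ∑ i, pd i (pd j φ) x * fluxM u v i j x|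
      ≤ ∑ j : Fin 3, ∑ i : Fin 3, C * r ^ 2 * (3 * quadSum u v P x) := by
    refine (Finset.abs_sum_le_sum_abs _ _).trans (Finset.sum_le_sum fun j _ =>
      (Finset.abs_sum_le_sum_abs _ _).trans (Finset.sum_le_sum fun i _ => ?_))
    rw [abs_mul]
    exact mul_le_mul (h2 i j) (abs_fluxM_le u v P i j x) (abs_nonneg _) hC2
  have t2 : |∑ j, pd j φ x * fluxN u v P j x|
      ≤ ∑ j : Fin 3, C * r * (6 * (vecNorm u x * quadSum u v P x)) := by
    refine (Finset.abs_sum_le_sum_abs _ _).trans (Finset.sum_le_sum fun j _ => ?_)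
    rw [abs_mul]
    exact mul_le_mul (h1 j) (abs_fluxN_le u v P j x) (abs_nonneg _) hC1
  simp only [Finset.sum_const, Finset.card_univ, Fintype.card_fin, nsmul_eq_mul] at t1 t2
  push_cast at t1 t2
  have := mul_nonneg hC1 (mul_nonneg ha hq)
  have := abs_sub (∑ j, ∑ i, pd i (pd j φ) x * fluxM u v i j x) (∑ j, pd j φ x * fluxN u v P j x)
  nlinarith

theorem integral_mul_energyRate_le {T : ℝ} {u v : ℝ → E3 → Fin 3 → ℝ} {P : ℝ → E3 → ℝ}
    (hu : ∀ i, ContDiff ℝ (⊤ : ℕ∞) fun q : ℝ × E3 => u q.1 q.2 i)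
    (hv : ∀ i, ContDiff ℝ (⊤ : ℕ∞) fun q : ℝ × E3 => v q.1 q.2 i)
    (hP : ContDiff ℝ (⊤ : ℕ∞) fun q : ℝ × E3 => P q.1 q.2)
    (hunit : ∀ t ∈ Set.Icc (0 : ℝ) T, ∀ x : E3, ∑ i, (v t x i) ^ 2 = 1)
    (hsol : EvolEL T u P v) {φ : E3 → ℝ} (hφ : ContDiff ℝ (⊤ : ℕ∞) φ) (hs : HasCompactSupport φ)
    (hφ0 : ∀ x, 0 ≤ φ x) {C R : ℝ} (h1 : ∀ j x, |pd j φ x| ≤ C * R⁻¹)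
    (h2 : ∀ i j x, |pd i (pd j φ) x| ≤ C * R⁻¹ ^ 2)
    (h3 : ∀ x, x ∉ ann R → (∀ j, pd j φ x = 0) ∧ ∀ i j, pd i (pd j φ) x = 0)
    {t : ℝ} (ht : t ∈ Set.Icc 0 T) :
    ∫ x, φ x * energyRate u v t x ≤ ∫ x in ann R, 27 * C *
      (R⁻¹ ^ 2 * quadSum (u t) (v t) (P t) x
        + R⁻¹ * (vecNorm (u t) x * quadSum (u t) (v t) (P t) x)) := by
  have hut := fun i => contDiff_slice (hu i) t
  have hvt := fun i => contDiff_slice (hv i) t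
  have hPt := contDiff_slice hP t
  have hM := contDiff_fluxM hut hvt
  have hN := contDiff_fluxN hut hvt hPt
  have hpt : ∀ x, energyRate u v t x
      ≤ ∑ j, pd j (fun y => ∑ i, pd i (fluxM (u t) (v t) i j) y + fluxN (u t) (v t) (P t) j y) x :=
    energy_density_le (ut := fun x i => deriv (fun s => u s x i) t)
      (w := fun x i => deriv (fun s => v s x i) t) hut
      (fun i => contDiff_slice (contDiff_deriv_slice (hu i)) t) hvt
      (fun i => contDiff_slice (contDiff_deriv_slice (hv i)) t) hPt
      (hsol.1 t ht) (hsol.2.1 t ht) (hsol.2.2 t ht) (hunit t ht)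
  have hdivc : Continuous fun x => ∑ j, pd j (fun y => ∑ i, pd i (fluxM (u t) (v t) i j) y
      + fluxN (u t) (v t) (P t) j y) x :=
    continuous_finsetSum _ fun j _ => (contDiff_pd
      ((ContDiff.sum fun i _ => contDiff_pd (hM i j) i).add (hN j)) j).continuous
  have hrate : Continuous fun x => energyRate u v t x :=
    (continuous_energyRate hu hv).comp (Continuous.prodMk_right t)
  have hqc : Continuous fun x => quadSum (u t) (v t) (P t) x :=
    (continuous_quadSum hu hv hP).comp (Continuous.prodMk_right t)
  have hac : Continuous fun x => vecNorm (u t) x :=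
    (continuous_vecNorm hu).comp (Continuous.prodMk_right t)
  have hfc : Continuous fun x => ∑ j, ∑ i, pd i (pd j φ) x * fluxM (u t) (v t) i j x
      - ∑ j, pd j φ x * fluxN (u t) (v t) (P t) j x := by
    have d1 := fun j => contDiff_pd hφ j
    exact (continuous_finsetSum _ fun j _ => continuous_finsetSum _ fun i _ =>
      (contDiff_pd (d1 j) i).continuous.mul (hM i j).continuous).sub
      (continuous_finsetSum _ fun j _ => (d1 j).continuous.mul (hN j).continuous)
  have hint : ∀ {f : E3 → ℝ}, Continuous f → IntegrableOn f (ann R) := fun hf =>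
    (hf.continuousOn.integrableOn_compact (isCompact_closedBall (0 : E3) R)).mono_set
      ((ann_subset_ball R).trans ball_subset_closedBall)
  calc ∫ x, φ x * energyRate u v t x
      ≤ ∫ x, φ x * ∑ j, pd j (fun y => ∑ i, pd i (fluxM (u t) (v t) i j) y
          + fluxN (u t) (v t) (P t) j y) x :=
        integral_mono ((hφ.continuous.mul hrate).integrable_of_hasCompactSupport hs.mul_right)
          ((hφ.continuous.mul hdivc).integrable_of_hasCompactSupport hs.mul_right)
          fun x => mul_le_mul_of_nonneg_left (hpt x) (hφ0 x)
    _ = ∫ x, (∑ j, ∑ i, pd i (pd j φ) x * fluxM (u t) (v t) i j x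
          - ∑ j, pd j φ x * fluxN (u t) (v t) (P t) j x) := integral_mul_div_flux hφ hs hM hN
    _ = ∫ x in ann R, (∑ j, ∑ i, pd i (pd j φ) x * fluxM (u t) (v t) i j x
          - ∑ j, pd j φ x * fluxN (u t) (v t) (P t) j x) :=
        (setIntegral_eq_integral_of_forall_compl_eq_zero fun x hx => by
          simp [(h3 x hx).1, (h3 x hx).2]).symm
    _ ≤ _ := setIntegral_mono (hint hfc) (hint (by fun_prop)) fun x =>
        (le_abs_self _).trans (abs_flux_pairing_le (fun j => h1 j x) fun i j => h2 i j x)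

theorem local_energy_le {T : ℝ} {u v : ℝ → E3 → Fin 3 → ℝ} {P : ℝ → E3 → ℝ}
    (hu : ∀ i, ContDiff ℝ (⊤ : ℕ∞) fun q : ℝ × E3 => u q.1 q.2 i)
    (hv : ∀ i, ContDiff ℝ (⊤ : ℕ∞) fun q : ℝ × E3 => v q.1 q.2 i)
    (hP : ContDiff ℝ (⊤ : ℕ∞) fun q : ℝ × E3 => P q.1 q.2)
    (hunit : ∀ t ∈ Set.Icc (0 : ℝ) T, ∀ x : E3, ∑ i, (v t x i) ^ 2 = 1)
    (hsol : EvolEL T u P v) (h0 : ∀ x, energy u v 0 x = 0) :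
    ∃ C : ℝ, ∀ R : ℝ, 0 < R → ∀ t ∈ Set.Icc 0 T, ∫ x in ball (0 : E3) (R / 2), energy u v t x
      ≤ C * ∫ q in Set.Icc 0 T ×ˢ ann R, (R⁻¹ ^ 2 * quadSum (u q.1) (v q.1) (P q.1) q.2
        + R⁻¹ * (vecNorm (u q.1) q.2 * quadSum (u q.1) (v q.1) (P q.1) q.2)) := by
  obtain ⟨C, hC, hcut⟩ := exists_cutoff
  refine ⟨27 * C, fun R hR t ht => ?_⟩
  obtain ⟨φ, hφ, hs, hφ0, hφ1, h1, h2, h3⟩ := hcut R hR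
  have hec := continuous_energy hu hv
  have hrc := continuous_energyRate hu hv
  have hqc := continuous_quadSum hu hv hP
  have hac := continuous_vecNorm hu
  have het : Continuous fun x => energy u v t x := hec.comp (Continuous.prodMk_right t)
  have he0 : ∀ t x, 0 ≤ energy u v t x := fun t x => by unfold energy gradSq; positivity
  have hint : Integrable fun x => φ x * energy u v t x :=
    (hφ.continuous.mul het).integrable_of_hasCompactSupport hs.mul_right
  set B : ℝ × E3 → ℝ := fun q => 27 * C * (R⁻¹ ^ 2 * quadSum (u q.1) (v q.1) (P q.1) q.2
        + R⁻¹ * (vecNorm (u q.1) q.2 * quadSum (u q.1) (v q.1) (P q.1) q.2)) with hB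
  have hBc : Continuous B := by fun_prop
  have hB0 : ∀ q, 0 ≤ B q := fun q => by
    have : 0 ≤ quadSum (u q.1) (v q.1) (P q.1) q.2 := by unfold quadSum gradSq; positivity
    have : 0 ≤ vecNorm (u q.1) q.2 := Real.sqrt_nonneg _
    positivity
  have hG : Continuous fun q : ℝ × E3 => φ q.2 * energyRate u v q.1 q.2 :=
    (hφ.continuous.comp continuous_snd).mul hrc
  have hGi : Integrable (fun q : ℝ × E3 => φ q.2 * energyRate u v q.1 q.2)
      ((volume.restrict (Set.Ioc 0 t)).prod volume) := by
    have : IntegrableOn (fun q : ℝ × E3 => φ q.2 * energyRate u v q.1 q.2)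
        (Set.Ioc 0 t ×ˢ Set.univ) := by
      refine IntegrableOn.of_forall_sdiff_eq_zero (s := Set.Ioc 0 t ×ˢ tsupport φ) ?_
        (measurableSet_Ioc.prod MeasurableSet.univ) ?_
      · exact (hG.continuousOn.integrableOn_compact
          ((isCompact_Icc (a := 0) (b := t)).prod hs)).mono_set
          (Set.prod_mono Set.Ioc_subset_Icc_self subset_rfl)
      · intro q hq
        have : q.2 ∉ tsupport φ := fun h => hq.2 ⟨hq.1.1, h⟩
        simp [image_eq_zero_of_notMem_tsupport this]
    rw [IntegrableOn, Measure.volume_eq_prod, ← Measure.prod_restrict, Measure.restrict_univ] at this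
    exact this
  have hBi : Integrable B ((volume.restrict (Set.Icc 0 T)).prod (volume.restrict (ann R))) := by
    rw [Measure.prod_restrict]
    exact integrableOn_Icc_prod hBc T R (ann_subset_ball R)
  calc ∫ x in ball (0 : E3) (R / 2), energy u v t x
      = ∫ x in ball (0 : E3) (R / 2), φ x * energy u v t x :=
        setIntegral_congr_fun measurableSet_ball fun x hx => by
          simp [hφ1 x (by simpa using (mem_ball_zero_iff.1 hx).le)]
    _ ≤ ∫ x, φ x * energy u v t x :=
        setIntegral_le_integral hint (ae_of_all _ fun x => mul_nonneg (hφ0 x) (he0 t x))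
    _ = ∫ x, ∫ s in Set.Ioc 0 t, φ x * energyRate u v s x := by
        refine integral_congr_ae (ae_of_all _ fun x => ?_)
        have hcx : Continuous fun s => energyRate u v s x := hrc.comp (Continuous.prodMk_left x)
        have := intervalIntegral.integral_eq_sub_of_hasDerivAt (a := 0) (b := t)
          (fun s _ => hasDerivAt_energy hu hv s x) (hcx.intervalIntegrable _ _)
        rw [h0, sub_zero, intervalIntegral.integral_of_le ht.1] at this
        simp only [integral_const_mul, this]
    _ = ∫ s in Set.Ioc 0 t, ∫ x, φ x * energyRate u v s x :=
        (integral_integral_swap (f := fun s x => φ x * energyRate u v s x) hGi).symm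
    _ ≤ ∫ s in Set.Ioc 0 t, ∫ x in ann R, B (s, x) := by
        have hsub : Set.Ioc 0 t ⊆ Set.Icc 0 T := fun s hs => ⟨hs.1.le, hs.2.trans ht.2⟩
        refine setIntegral_mono_on hGi.integral_prod_left
          (IntegrableOn.mono_set (hBi.integral_prod_left) hsub) measurableSet_Ioc fun s hs' => ?_
        exact integral_mul_energyRate_le hu hv hP hunit hsol hφ hs hφ0 h1 h2 h3 (hsub hs')
    _ ≤ ∫ s in Set.Icc 0 T, ∫ x in ann R, B (s, x) :=
        setIntegral_mono_set hBi.integral_prod_left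
          (ae_of_all _ fun s => integral_nonneg fun x => hB0 _)
          (LE.le.eventuallyLE fun s hs => ⟨hs.1.le, hs.2.trans ht.2⟩)
    _ = ∫ q in Set.Icc 0 T ×ˢ ann R, B q := (setIntegral_Icc_prod hBc T R (ann_subset_ball R)).symm
    _ = _ := integral_const_mul _ _

theorem eq_zero_of_setIntegral_ball_le_zero {f : E3 → ℝ} (hf : Continuous f) (h0 : ∀ x, 0 ≤ f x)
    (h : ∀ r : ℝ, 0 < r → ∫ x in ball (0 : E3) r, f x ≤ 0) (x : E3) : f x = 0 := by
  set r := ‖x‖ + 1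
  have hr : 0 < r := by positivity
  have hi : IntegrableOn f (ball (0 : E3) r) :=
    (hf.continuousOn.integrableOn_compact (isCompact_closedBall (0 : E3) r)).mono_set
      ball_subset_closedBall
  have hz : ∫ x in ball (0 : E3) r, f x = 0 := le_antisymm (h r hr) (integral_nonneg h0)
  have hae := (integral_eq_zero_iff_of_nonneg h0 hi).1 hz
  have := Measure.eqOn_open_of_ae_eq hae isOpen_ball hf.continuousOn continuous_const.continuousOn
  exact this (by simp [r])

theorem liouville_nonstationary_EL
    (u v : ℝ → E3 → Fin 3 → ℝ) (P : ℝ → E3 → ℝ) (T γ p : ℝ) (hT : 0 < T)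
    (hu : ContDiff ℝ (⊤ : ℕ∞) (fun q : ℝ × E3 => u q.1 q.2))
    (hv : ContDiff ℝ (⊤ : ℕ∞) (fun q : ℝ × E3 => v q.1 q.2))
    (hP : ContDiff ℝ (⊤ : ℕ∞) (fun q : ℝ × E3 => P q.1 q.2))
    (hunit : ∀ t ∈ Set.Icc (0 : ℝ) T, ∀ x : E3, ∑ i, (v t x i) ^ 2 = 1)
    (hsol : EvolEL T u P v)
    (hγ0 : 0 < γ) (hγ3 : γ < 3) (hp3 : 3 ≤ p)
    (hη : γ / p - 3 / p + 2 / 3 ≤ 0)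
    (hum : MemMorreyT0 p γ T (fun t x => vecNorm (u t) x))
    (hvm : ∀ i k : Fin 3, MemMorreyT p γ T (fun t x => pd i (fun y => v t y k) x))
    (hPm : ∃ C : ℝ, ∀ R : ℝ, 1 ≤ R →
      R ^ (-γ) * ∫ t in Set.Icc (0 : ℝ) T, ∫ x in ball (0 : E3) R, |P t x| ^ (p / 2) ≤ C)
    (hu0 : ∀ x : E3, ∀ i : Fin 3, u 0 x i = 0)
    (hv0 : ∀ x : E3, ∀ i k : Fin 3, pd i (fun y => v 0 y k) x = 0) :
    ∀ t ∈ Set.Icc (0 : ℝ) T, ∀ x : E3,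
      (∀ i : Fin 3, u t x i = 0) ∧ (∀ i k : Fin 3, pd i (fun y => v t y k) x = 0) := by
  have hu' : ∀ i, ContDiff ℝ (⊤ : ℕ∞) fun q : ℝ × E3 => u q.1 q.2 i := fun i =>
    contDiff_pi.1 hu i
  have hv' : ∀ i, ContDiff ℝ (⊤ : ℕ∞) fun q : ℝ × E3 => v q.1 q.2 i := fun i =>
    contDiff_pi.1 hv i
  have h0 : ∀ x, energy u v 0 x = 0 := fun x => by simp [energy, gradSq, hu0, hv0]
  obtain ⟨C, hC⟩ := local_energy_le hu' hv' hP hunit hsol h0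
  have hac := continuous_vecNorm hu'
  have hdc : ∀ i k, Continuous fun q : ℝ × E3 => pd i (fun y => v q.1 y k) q.2 :=
    fun i k => (contDiff_pd_slice (hv' k) i).continuous
  have hac2 : Continuous fun q : ℝ × E3 => vecNorm (u q.1) q.2 ^ 2 := hac.pow 2
  have hdc2 : ∀ i k, Continuous fun q : ℝ × E3 => pd i (fun y => v q.1 y k) q.2 ^ 2 :=
    fun i k => (hdc i k).pow 2
  have ha : ∀ q : ℝ × E3, 0 ≤ vecNorm (u q.1) q.2 := fun q => Real.sqrt_nonneg _
  have hsq : ∀ y : ℝ, (y ^ 2) ^ (p / 2) = |y| ^ p := fun y => by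
    rw [← sq_abs, ← Real.rpow_natCast, ← Real.rpow_mul (abs_nonneg y)]
    congr 1
    push_cast
    ring
  have hmor : ∀ {f : ℝ → E3 → ℝ}, Continuous (fun q : ℝ × E3 => f q.1 q.2) →
      MemMorreyT p γ T f → ∃ C : ℝ, ∀ R : ℝ, 1 ≤ R →
        R ^ (-γ) * ∫ q in Set.Icc 0 T ×ˢ ball (0 : E3) R, (f q.1 q.2 ^ 2) ^ (p / 2) ≤ C := by
    intro f hf hm
    obtain ⟨C, hC⟩ := hm.2
    refine ⟨C, fun R hR => ?_⟩
    simp only [hsq]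
    rw [setIntegral_Icc_prod (hf.abs.rpow_const fun _ => Or.inr (by linarith)) T R subset_rfl]
    exact hC R hR
  have ham : Tendsto (fun R : ℝ => R ^ (-γ) * ∫ q in Set.Icc 0 T ×ˢ ann R,
      vecNorm (u q.1) q.2 ^ p) atTop (nhds 0) := by
    refine hum.2.congr fun R => ?_
    rw [setIntegral_Icc_prod (hac.rpow_const fun _ => Or.inr (by linarith)) T R (ann_subset_ball R)]
    simp only [abs_of_nonneg (Real.sqrt_nonneg _), vecNorm]
  have hPm' : ∃ C : ℝ, ∀ R : ℝ, 1 ≤ R →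
      R ^ (-γ) * ∫ q in Set.Icc 0 T ×ˢ ball (0 : E3) R, |P q.1 q.2| ^ (p / 2) ≤ C := by
    obtain ⟨C, hC⟩ := hPm
    refine ⟨C, fun R hR => ?_⟩
    rw [setIntegral_Icc_prod (hP.continuous.abs.rpow_const fun _ => Or.inr (by linarith)) T R
      subset_rfl]
    exact hC R hR
  have l1 := tendsto_annular_remainder hT hp3 hη hac hac2 ha (fun q => sq_nonneg _) ham
    (hmor hac hum.1)
  have l2 := fun i k => tendsto_annular_remainder hT hp3 hη hac (hdc2 i k) ha
    (fun q => sq_nonneg _) ham (hmor (hdc i k) (hvm i k))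
  have l3 := tendsto_annular_remainder hT hp3 hη hac hP.continuous.abs ha
    (fun q => abs_nonneg _) ham hPm'
  have hlim := ((l1.add (tendsto_finsetSum Finset.univ fun i _ =>
    tendsto_finsetSum Finset.univ fun k _ => l2 i k)).add l3).const_mul C
  simp only [Finset.sum_const_zero, add_zero, mul_zero] at hlim
  have hsplit : ∀ R : ℝ, ∫ q in Set.Icc 0 T ×ˢ ann R,
      (R⁻¹ ^ 2 * quadSum (u q.1) (v q.1) (P q.1) q.2
        + R⁻¹ * (vecNorm (u q.1) q.2 * quadSum (u q.1) (v q.1) (P q.1) q.2))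
      = (∫ q in Set.Icc 0 T ×ˢ ann R, (R⁻¹ ^ 2 * vecNorm (u q.1) q.2 ^ 2
          + R⁻¹ * (vecNorm (u q.1) q.2 * vecNorm (u q.1) q.2 ^ 2)))
        + (∑ i, ∑ k, ∫ q in Set.Icc 0 T ×ˢ ann R, (R⁻¹ ^ 2 * pd i (fun y => v q.1 y k) q.2 ^ 2
          + R⁻¹ * (vecNorm (u q.1) q.2 * pd i (fun y => v q.1 y k) q.2 ^ 2)))
        + ∫ q in Set.Icc 0 T ×ˢ ann R, (R⁻¹ ^ 2 * |P q.1 q.2|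
          + R⁻¹ * (vecNorm (u q.1) q.2 * |P q.1 q.2|)) := fun R => by
    have hi : ∀ {w : ℝ × E3 → ℝ}, Continuous w → IntegrableOn
        (fun q => R⁻¹ ^ 2 * w q + R⁻¹ * (vecNorm (u q.1) q.2 * w q)) (Set.Icc 0 T ×ˢ ann R) :=
      fun hw => integrableOn_Icc_prod (by fun_prop) T R (ann_subset_ball R)
    have i2 := fun i k => hi (hdc2 i k)
    have i2' := fun i => integrable_finsetSum Finset.univ fun k _ => i2 i k
    have i1 := hi hac2
    have i12 := i1.add (integrable_finsetSum Finset.univ fun i _ => i2' i)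
    simp only [Pi.add_def] at i12
    rw [Finset.sum_congr rfl fun i _ => (integral_finsetSum Finset.univ fun k _ => i2 i k).symm,
      ← integral_finsetSum Finset.univ fun i _ => i2' i,
      ← integral_add i1 (integrable_finsetSum Finset.univ fun i _ => i2' i),
      ← integral_add i12 (hi hP.continuous.abs)]
    congr 1 with q
    have hvn : vecNorm (u q.1) q.2 ^ 2 = ∑ i, u q.1 q.2 i ^ 2 := Real.sq_sqrt (by positivity)
    simp only [Finset.sum_add_distrib, ← Finset.mul_sum]
    rw [hvn, quadSum, gradSq]
    ring
  have hec := continuous_energy hu' hv'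
  intro t ht x
  have hnn : ∀ x, 0 ≤ energy u v t x := fun x => by unfold energy gradSq; positivity
  have het : Continuous (energy u v t) := hec.comp (Continuous.prodMk_right t)
  have hz : energy u v t x = 0 := by
    refine eq_zero_of_setIntegral_ball_le_zero het hnn (fun r hr => ge_of_tendsto hlim ?_) x
    filter_upwards [eventually_ge_atTop (2 * r)] with R hR
    rw [← hsplit R]
    refine le_trans (setIntegral_mono_set ?_ (ae_of_all _ hnn) ?_) (hC R (by linarith) t ht)
    · exact (het.continuousOn.integrableOn_compact (isCompact_closedBall (0 : E3) (R / 2))).mono_set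
        ball_subset_closedBall
    · exact LE.le.eventuallyLE (ball_subset_ball (by linarith))
  obtain ⟨hz1, hz2⟩ := (add_eq_zero_iff_of_nonneg (by positivity)
    (by unfold gradSq; positivity)).1 hz
  refine ⟨fun i => ?_, fun i k => ?_⟩
  · exact pow_eq_zero_iff two_ne_zero |>.1
      ((Finset.sum_eq_zero_iff_of_nonneg fun i _ => sq_nonneg _).1 hz1 i (Finset.mem_univ i))
  · have := (Finset.sum_eq_zero_iff_of_nonneg fun i _ =>
      Finset.sum_nonneg fun k _ => sq_nonneg _).1 hz2 i (Finset.mem_univ i)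
    exact pow_eq_zero_iff two_ne_zero |>.1
      ((Finset.sum_eq_zero_iff_of_nonneg fun k _ => sq_nonneg _).1 this k (Finset.mem_univ k))
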